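/- arXiv:1506.03303 — 2 statements merged into one kernel-verified Lean document; each statement's English description precedes it below -/
import Mathlib

section
/- Let G be a finite group, F a field with char(F) not dividing |G|, and H ⊆ K subgroups of G. Set e = Ĥ − K̂. Then the left ideal (FG)e has dimension over F equal to [G:H] − [G:K]. -/
open scoped Classical

/-- `hat F S` is the element `Ŝ = (1/|S|) ∑_{s ∈ S} s` of the group algebra `F G`. -/
noncomputable def hat (F : Type*) [Field F] {G : Type*} [Group G] [Fintype G]
    (S : Subgroup G) : MonoidAlgebra F G :=
  (Nat.card S : F)⁻¹ • ∑ g : G, if g ∈ S then MonoidAlgebra.of F G g else 0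

lemma forall_mul_of_eq_self_iff {F : Type*} [Field F] {G : Type*} [Group G]
    {S : Subgroup G} {x : MonoidAlgebra F G} :
    (∀ h ∈ S, x * MonoidAlgebra.of F G h = x) ↔ ∀ g, ∀ h ∈ S, x.coeff (g * h) = x.coeff g := by
  constructor
  · intro hx g h hh
    conv_lhs => rw [← hx h hh]
    simp [MonoidAlgebra.of_apply]
  · intro hx h hh
    ext g
    rw [MonoidAlgebra.of_apply, MonoidAlgebra.coeff_mul_single_apply, mul_one]
    exact hx g h⁻¹ (S.inv_mem hh)

section

variable {F : Type*} [Field F] {G : Type*} [Group G] [Fintype G]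

lemma natCard_subgroup_cast_ne_zero (hchar : (Fintype.card G : F) ≠ 0) (S : Subgroup G) :
    (Nat.card S : F) ≠ 0 := by
  rw [← Nat.card_eq_fintype_card, ← S.card_mul_index, Nat.cast_mul] at hchar
  exact left_ne_zero_of_mul hchar

lemma sum_ite_mem_const {M : Type*} [AddCommMonoid M] (S : Subgroup G) (x : M) :
    (∑ g : G, if g ∈ S then x else 0) = Nat.card S • x := by
  rw [← Finset.sum_filter, Finset.sum_const, Nat.card_eq_fintype_card, Fintype.card_subtype]

lemma hat_mul_of {S : Subgroup G} {h : G} (hh : h ∈ S) :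
    hat F S * MonoidAlgebra.of F G h = hat F S := by
  rw [hat, smul_mul_assoc, Finset.sum_mul]
  congr 1
  refine Fintype.sum_equiv (Equiv.mulRight h) _ _ fun g ↦ ?_
  simp only [Equiv.coe_mulRight, S.mul_mem_cancel_right hh, map_mul, ite_mul, zero_mul]

lemma of_mul_hat {S : Subgroup G} {h : G} (hh : h ∈ S) :
    MonoidAlgebra.of F G h * hat F S = hat F S := by
  rw [hat, mul_smul_comm, Finset.mul_sum]
  congr 1
  refine Fintype.sum_equiv (Equiv.mulLeft h) _ _ fun g ↦ ?_
  simp only [Equiv.coe_mulLeft, S.mul_mem_cancel_left hh, map_mul, mul_ite, mul_zero]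

lemma mul_hat_eq_self {S : Subgroup G} (hS : (Nat.card S : F) ≠ 0) {x : MonoidAlgebra F G}
    (hx : ∀ h ∈ S, x * MonoidAlgebra.of F G h = x) : x * hat F S = x := by
  have key : ∀ g : G, x * (if g ∈ S then MonoidAlgebra.of F G g else 0) =
      if g ∈ S then x else 0 := fun g ↦ by
    split_ifs with hg
    · exact hx g hg
    · exact mul_zero x
  rw [hat, mul_smul_comm, Finset.mul_sum, Finset.sum_congr rfl fun g _ ↦ key g,
    sum_ite_mem_const, ← Nat.cast_smul_eq_nsmul F, inv_smul_smul₀ hS]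

lemma hat_mul_eq_self {S : Subgroup G} (hS : (Nat.card S : F) ≠ 0) {x : MonoidAlgebra F G}
    (hx : ∀ h ∈ S, MonoidAlgebra.of F G h * x = x) : hat F S * x = x := by
  have key : ∀ g : G, (if g ∈ S then MonoidAlgebra.of F G g else 0) * x =
      if g ∈ S then x else 0 := fun g ↦ by
    split_ifs with hg
    · exact hx g hg
    · exact zero_mul x
  rw [hat, smul_mul_assoc, Finset.sum_mul, Finset.sum_congr rfl fun g _ ↦ key g,
    sum_ite_mem_const, ← Nat.cast_smul_eq_nsmul F, inv_smul_smul₀ hS]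

lemma mem_span_hat {S : Subgroup G} (hS : (Nat.card S : F) ≠ 0) {x : MonoidAlgebra F G} :
    x ∈ Ideal.span {hat F S} ↔ ∀ h ∈ S, x * MonoidAlgebra.of F G h = x := by
  rw [Ideal.mem_span_singleton']
  constructor
  · rintro ⟨a, rfl⟩ h hh
    rw [mul_assoc, hat_mul_of hh]
  · exact fun hx ↦ ⟨x, mul_hat_eq_self hS hx⟩

lemma ofCoeff_comp_mk_mem_span_hat {S : Subgroup G} (hS : (Nat.card S : F) ≠ 0) (f : G ⧸ S → F) :
    MonoidAlgebra.ofCoeff (Finsupp.equivFunOnFinite.symm fun g : G ↦ f g) ∈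
      (Ideal.span {hat F S}).restrictScalars F := by
  rw [Submodule.restrictScalars_mem, mem_span_hat hS, forall_mul_of_eq_self_iff]
  intro g h hh
  exact congrArg f (QuotientGroup.mk_mul_of_mem g hh)

/-- A function on the left cosets of `S`, viewed as an element of the left ideal `(FG)Ŝ`. -/
noncomputable def quotientFunToSpanHat {S : Subgroup G} (hS : (Nat.card S : F) ≠ 0) :
    (G ⧸ S → F) →ₗ[F] (Ideal.span {hat F S}).restrictScalars F where
  toFun f := ⟨_, ofCoeff_comp_mk_mem_span_hat hS f⟩
  map_add' _ _ := by ext; rfl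
  map_smul' _ _ := by ext; rfl

/-- The left ideal `(FG)Ŝ` is the space of functions on the left cosets of `S`. -/
noncomputable def quotientFunEquivSpanHat {S : Subgroup G} (hS : (Nat.card S : F) ≠ 0) :
    (G ⧸ S → F) ≃ₗ[F] (Ideal.span {hat F S}).restrictScalars F :=
  LinearEquiv.ofBijective (quotientFunToSpanHat hS)
    ⟨fun f₁ f₂ hf ↦ by
      ext q
      induction q using QuotientGroup.induction_on with | H g => ?_
      exact congrArg (fun x ↦ x.1.coeff g) hf,
    fun ⟨x, hx⟩ ↦ by
      rw [Submodule.restrictScalars_mem, mem_span_hat hS, forall_mul_of_eq_self_iff] at hx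
      refine ⟨fun q ↦ Quotient.liftOn' q (fun g ↦ x.coeff g) fun a b hab ↦ ?_, ?_⟩
      · rw [QuotientGroup.leftRel_apply] at hab
        simpa using (hx a _ hab).symm
      · ext g
        rfl⟩

lemma finrank_span_hat {S : Subgroup G} (hS : (Nat.card S : F) ≠ 0) :
    Module.finrank F ((Ideal.span {hat F S}).restrictScalars F) = S.index := by
  rw [← (quotientFunEquivSpanHat hS).finrank_eq, Module.finrank_fintype_fun_eq_card,
    S.index_eq_card, Nat.card_eq_fintype_card]

end

theorem stmt1 {F : Type*} [Field F] {G : Type*} [Group G] [Fintype G]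
    (hchar : (Fintype.card G : F) ≠ 0)
    (H K : Subgroup G) (hHK : H ≤ K) :
    Module.finrank F
        (Submodule.restrictScalars F (Ideal.span {hat F H - hat F K})) =
      H.index - K.index := by
  have hH := natCard_subgroup_cast_ne_zero hchar H
  have hK := natCard_subgroup_cast_ne_zero hchar K
  have hHH : hat F H * hat F H = hat F H := mul_hat_eq_self hH fun _ ↦ hat_mul_of
  have hKK : hat F K * hat F K = hat F K := mul_hat_eq_self hK fun _ ↦ hat_mul_of
  have hKH : hat F K * hat F H = hat F K := mul_hat_eq_self hH fun _ h ↦ hat_mul_of (hHK h)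
  have hHK' : hat F H * hat F K = hat F K := hat_mul_eq_self hH fun _ h ↦ of_mul_hat (hHK h)
  have hsup : (Ideal.span {hat F H - hat F K}).restrictScalars F ⊔
      (Ideal.span {hat F K}).restrictScalars F = (Ideal.span {hat F H}).restrictScalars F := by
    apply le_antisymm
    · refine sup_le ?_ ?_ <;> intro x hx <;>
        rw [Submodule.restrictScalars_mem, Ideal.mem_span_singleton'] at hx ⊢ <;>
        obtain ⟨a, rfl⟩ := hx
      · exact ⟨a * (hat F H - hat F K), by rw [mul_assoc, sub_mul, hHH, hKH]⟩
      · exact ⟨a * hat F K, by rw [mul_assoc, hKH]⟩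
    · intro x hx
      rw [Submodule.restrictScalars_mem, Ideal.mem_span_singleton'] at hx
      obtain ⟨a, rfl⟩ := hx
      rw [← sub_add_cancel (hat F H) (hat F K), mul_add, sub_add_cancel]
      exact Submodule.add_mem_sup (Ideal.mem_span_singleton'.2 ⟨a, rfl⟩)
        (Ideal.mem_span_singleton'.2 ⟨a, rfl⟩)
  have hinf : (Ideal.span {hat F H - hat F K}).restrictScalars F ⊓
      (Ideal.span {hat F K}).restrictScalars F = ⊥ := by
    refine (Submodule.eq_bot_iff _).2 fun x ⟨hx₁, hx₂⟩ ↦ ?_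
    obtain ⟨a, rfl⟩ := Ideal.mem_span_singleton'.1 hx₁
    obtain ⟨b, hb⟩ := Ideal.mem_span_singleton'.1 hx₂
    calc a * (hat F H - hat F K) = b * hat F K * hat F K := by rw [mul_assoc, hKK, hb]
      _ = 0 := by rw [hb, mul_assoc, sub_mul, hHK', hKK, sub_self, mul_zero]
  have hfin : Module.Finite F (MonoidAlgebra F G) := inferInstance
  have hdim := Submodule.finrank_sup_add_finrank_inf_eq
    ((Ideal.span {hat F H - hat F K}).restrictScalars F)
    ((Ideal.span {hat F K}).restrictScalars F)
  rw [hsup, hinf, finrank_bot, finrank_span_hat hH, finrank_span_hat hK] at hdim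
  omega
end

section
/- Let p be an odd prime, F_q a finite field with gcd(2p^m, q) = 1 such that q generates the unit group of Z/p^m. Let D be the dihedral group of order 2p^m, e = e_j = Ĥ_j − Ĥ_{j−1} for some 1 ≤ j ≤ m, and f = e₁₁ − e₁₂. Then the set {f, af, a²f, ..., a^{φ(p^j)−1}f} is an F_q-basis of the left ideal I = (F_q D)f. -/
open scoped Classical

open Polynomial in
/-- The polynomial whose value at a generator `a` of a cyclic group of order `p ^ m` is the
averaging idempotent of the subgroup generated by `a ^ p ^ d`. -/
noncomputable def hatPoly (F : Type*) [Field F] (p m d : ℕ) : Polynomial F :=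
  C ((p ^ (m - d) : ℕ) : F)⁻¹ * ∑ k ∈ Finset.range (p ^ (m - d)), (X ^ p ^ d) ^ k

theorem hat_zpowers (F : Type*) [Field F] {G : Type*} [Group G] [Fintype G] (x : G) :
    hat F (Subgroup.zpowers x) = (orderOf x : F)⁻¹ •
      ∑ k ∈ Finset.range (orderOf x), MonoidAlgebra.of F G x ^ k := by
  rw [hat, Nat.card_zpowers, ← Finset.sum_filter]
  congr 1
  have h : Finset.univ.filter (fun g => g ∈ Subgroup.zpowers x) =
      (Finset.range (orderOf x)).image (fun k => x ^ k) := by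
    ext g
    simp [mem_zpowers_iff_mem_range_orderOf]
  rw [h, Finset.sum_image]
  · simp only [map_pow]
  · intro k hk l hl hkl
    exact pow_injOn_Iio_orderOf (by simpa using hk) (by simpa using hl) hkl

theorem commute_hat (F : Type*) [Field F] {G : Type*} [Group G] [Fintype G] (S : Subgroup G)
    [S.Normal] (g : G) : Commute (MonoidAlgebra.of F G g) (hat F S) := by
  refine Commute.smul_right ?_ _
  rw [commute_iff_eq, Finset.mul_sum, Finset.sum_mul]
  refine Fintype.sum_equiv (MulAut.conj g).toEquiv _ _ fun x => ?_
  have h : g * x * g⁻¹ ∈ S ↔ x ∈ S := by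
    refine ⟨fun hx => ?_, fun hx => Subgroup.Normal.conj_mem inferInstance x hx g⟩
    simpa [mul_assoc] using Subgroup.Normal.conj_mem inferInstance _ hx g⁻¹
  by_cases hx : x ∈ S
  · simp [hx, h]
  · simp [hx, h]

theorem normal_zpowers_r {n : ℕ} (i : ZMod n) :
    (Subgroup.zpowers (DihedralGroup.r i)).Normal := by
  refine ⟨fun x hx g => ?_⟩
  obtain ⟨k, rfl⟩ := Subgroup.mem_zpowers_iff.1 hx
  rcases g with l | l
  · refine Subgroup.mem_zpowers_iff.2 ⟨k, ?_⟩
    simp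
  · refine Subgroup.mem_zpowers_iff.2 ⟨-k, ?_⟩
    simp

theorem hat_zpowers_r (F : Type*) [Field F] {p m d : ℕ} [NeZero (p ^ m)] (hp : p.Prime)
    (hd : d ≤ m) :
    hat F (Subgroup.zpowers ((DihedralGroup.r 1 : DihedralGroup (p ^ m)) ^ p ^ d)) =
      Polynomial.aeval (MonoidAlgebra.of F (DihedralGroup (p ^ m)) (DihedralGroup.r 1))
        (hatPoly F p m d) := by
  have h : orderOf ((DihedralGroup.r 1 : DihedralGroup (p ^ m)) ^ p ^ d) = p ^ (m - d) := by
    rw [orderOf_pow_of_dvd (pow_ne_zero _ hp.ne_zero), DihedralGroup.orderOf_r_one,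
      Nat.pow_div hd hp.pos]
    rw [DihedralGroup.orderOf_r_one]
    exact pow_dvd_pow p hd
  rw [hat_zpowers, h, hatPoly, map_mul, Polynomial.aeval_C, Algebra.smul_def]
  simp

open Polynomial in
theorem hatPoly_geom (F : Type*) [Field F] {p m d : ℕ} (hd : d ≤ m) (hp : (p : F) ≠ 0) :
    C ((p ^ (m - d) : ℕ) : F) * hatPoly F p m d * (X ^ p ^ d - 1) = X ^ p ^ m - 1 := by
  have h : ((p ^ (m - d) : ℕ) : F) ≠ 0 := by
    push_cast
    exact pow_ne_zero _ hp
  rw [hatPoly, ← mul_assoc, ← C_mul, mul_inv_cancel₀ h, C_1, one_mul, geom_sum_mul, ← pow_mul,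
    ← pow_add, Nat.add_sub_cancel' hd]

open Polynomial in
/-- The cyclotomic polynomial annihilates the idempotent. -/
theorem dvd_cyclotomic_mul_hatPoly_sub (F : Type*) [Field F] {p m i : ℕ} (hp : p.Prime)
    (him : i + 1 ≤ m) (hpF : (p : F) ≠ 0) :
    (X ^ p ^ m - 1 : F[X]) ∣
      cyclotomic (p ^ (i + 1)) F * (hatPoly F p m (i + 1) - hatPoly F p m i) := by
  have := Fact.mk hp
  have hne : ∀ d, (X ^ p ^ d - 1 : F[X]) ≠ 0 := fun d =>
    (monic_X_pow_sub_C 1 (pow_ne_zero _ hp.ne_zero)).ne_zero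
  have hc : C ((p ^ (m - (i + 1)) : ℕ) : F) ≠ 0 :=
    C_ne_zero.2 (by exact_mod_cast pow_ne_zero _ hpF)
  have hcyc := cyclotomic_prime_pow_mul_X_pow_sub_one F p i
  have h1 := hatPoly_geom F him hpF
  have h0 := hatPoly_geom F (Nat.le_of_succ_le him) hpF
  have hpow : p ^ (m - i) = p ^ (m - (i + 1)) * p := by
    rw [← pow_succ]; congr 1; omega
  have key : cyclotomic (p ^ (i + 1)) F * hatPoly F p m (i + 1) = C (p : F) * hatPoly F p m i := by
    refine mul_left_cancel₀ hc (mul_right_cancel₀ (hne i) ?_)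
    rw [hpow, Nat.cast_mul, C_mul] at h0
    linear_combination h1 - h0 + C ((p ^ (m - (i + 1)) : ℕ) : F) * hatPoly F p m (i + 1) * hcyc
  have hdvd : (X ^ p ^ i - 1 : F[X]) ∣ C (p : F) - cyclotomic (p ^ (i + 1)) F := by
    have : (C (p : F) - cyclotomic (p ^ (i + 1)) F : F[X]) =
        -∑ k ∈ Finset.range p, ((X ^ p ^ i) ^ k - 1) := by
      rw [cyclotomic_prime_pow_eq_geom_sum hp]
      simp
    rw [this, dvd_neg]
    exact Finset.dvd_sum fun k _ => by simpa using sub_dvd_pow_sub_pow (X ^ p ^ i : F[X]) 1 k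
  obtain ⟨u, hu⟩ := hdvd
  have hc' : C ((p ^ (m - i) : ℕ) : F)⁻¹ * C ((p ^ (m - i) : ℕ) : F) = 1 := by
    rw [← C_mul, inv_mul_cancel₀ (by exact_mod_cast pow_ne_zero _ hpF), C_1]
  refine ⟨C ((p ^ (m - i) : ℕ) : F)⁻¹ * u, ?_⟩
  linear_combination key + hatPoly F p m i * hu +
    C ((p ^ (m - i) : ℕ) : F)⁻¹ * u * h0 - (X ^ p ^ i - 1) * hatPoly F p m i * u * hc'

open Polynomial in
/-- At a primitive root of unity of order `p ^ (i + 1)` the idempotent takes the value `1`. -/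
theorem aeval_hatPoly_sub {F K : Type*} [Field F] [Field K] [Algebra F K] {p m i : ℕ}
    (hp : p.Prime) (him : i + 1 ≤ m) (hpF : (p : F) ≠ 0) {ζ : K}
    (hζ : IsPrimitiveRoot ζ (p ^ (i + 1))) :
    aeval ζ (hatPoly F p m (i + 1) - hatPoly F p m i) = 1 := by
  have hc : ((p ^ (m - (i + 1)) : ℕ) : F) ≠ 0 := by
    exact_mod_cast pow_ne_zero _ hpF
  have h1 : aeval ζ (hatPoly F p m (i + 1)) = 1 := by
    simp only [hatPoly, map_mul, aeval_C, map_sum, map_pow, aeval_X, hζ.pow_eq_one, one_pow,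
      Finset.sum_const, Finset.card_range, nsmul_eq_mul, mul_one]
    rw [← map_natCast (algebraMap F K), ← map_mul, inv_mul_cancel₀ hc, map_one]
  have h0 : aeval ζ (hatPoly F p m i) = 0 := by
    have h := congrArg (aeval ζ) (hatPoly_geom F (Nat.le_of_succ_le him) hpF)
    have hm : ζ ^ p ^ m = 1 := (hζ.pow_eq_one_iff_dvd _).2 (pow_dvd_pow p him)
    have hi : ζ ^ p ^ i - 1 ≠ 0 := by
      rw [sub_ne_zero]
      exact hζ.pow_ne_one_of_pos_of_lt (pow_ne_zero _ hp.ne_zero)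
        (Nat.pow_lt_pow_right hp.one_lt i.lt_succ_self)
    have hci : algebraMap F K ((p ^ (m - i) : ℕ) : F) ≠ 0 :=
      (_root_.map_ne_zero _).2 (by exact_mod_cast pow_ne_zero _ hpF)
    simp only [map_mul, aeval_C, map_sub, map_pow, aeval_X, map_one, hm, sub_self] at h
    exact (mul_eq_zero.1 ((mul_eq_zero.1 h).resolve_right hi)).resolve_left hci
  rw [map_sub, h1, h0, sub_zero]

/-- The two-dimensional representation of the dihedral group induced from a character of the
rotation subgroup. -/
noncomputable def dihedralRep {K : Type*} [Field K] {n : ℕ} (χ : AddChar (ZMod n) K) :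
    DihedralGroup n →* Matrix (Fin 2) (Fin 2) K where
  toFun
    | .r i => !![χ i, 0; 0, χ (-i)]
    | .sr i => !![0, χ (-i); χ i, 0]
  map_one' := by
    rw [DihedralGroup.one_def]
    simp [Matrix.one_fin_two]
  map_mul' := by
    rintro (i | i) (k | k) <;>
      simp [← AddChar.map_add_eq_mul, sub_eq_add_neg, add_comm]

open Polynomial in
theorem aeval_diagonal {F K : Type*} [Field F] [Field K] [Algebra F K] (x y : K) (g : F[X]) :
    aeval !![x, 0; 0, y] g = !![aeval x g, 0; 0, aeval y g] := by
  induction g using Polynomial.induction_on' with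
  | add g h hg hh => simp [hg, hh]
  | monomial n c =>
    have h : (!![x, 0; 0, y] : Matrix (Fin 2) (Fin 2) K) ^ n = !![x ^ n, 0; 0, y ^ n] := by
      induction n with
      | zero => simp [Matrix.one_fin_two]
      | succ n ih => simp [pow_succ, ih]
    rw [← C_mul_X_pow_eq_monomial]
    simp only [map_mul, aeval_C, map_pow, aeval_X, h, ← Algebra.smul_def]
    simp

open Polynomial in
/-- If a monic polynomial in `a` kills `f`, the powers of `a` below its degree span all the
translates of `f` by polynomials in `a`. -/
theorem aeval_mul_mem_span {F R : Type*} [Field F] [Ring R] [Algebra F R] {a f : R} {Φ : F[X]}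
    (hΦ : Φ.Monic) (h : aeval a Φ * f = 0) (g : F[X]) :
    aeval a g * f ∈
      Submodule.span F (Set.range fun k : Fin Φ.natDegree => a ^ (k : ℕ) * f) := by
  have hg : aeval a g * f = aeval a (g %ₘ Φ) * f := by
    conv_lhs => rw [← modByMonic_add_div g Φ, mul_comm Φ]
    rw [map_add, map_mul, add_mul, mul_assoc, h, mul_zero, add_zero]
  rw [hg, aeval_eq_sum_range, Finset.sum_mul]
  refine Submodule.sum_mem _ fun k _ => ?_
  by_cases hk : k < Φ.natDegree
  · rw [smul_mul_assoc]
    exact Submodule.smul_mem _ _ (Submodule.subset_span ⟨⟨k, hk⟩, rfl⟩)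
  · have hdeg : (g %ₘ Φ).coeff k = 0 :=
      coeff_eq_zero_of_degree_lt (((degree_modByMonic_lt g hΦ).trans_le
        degree_le_natDegree).trans_le
        (by exact_mod_cast not_lt.1 hk))
    simp [hdeg]

open Polynomial in
/-- A polynomial of degree less than `φ(n)` vanishing at all primitive `n`-th roots of unity of
an algebraically closed field in which `n` is invertible is zero. -/
theorem eq_zero_of_forall_primitiveRoot {F K : Type*} [Field F] [Field K] [IsAlgClosed K]
    [Algebra F K] {n : ℕ} [NeZero (n : K)] {g : F[X]} (hdeg : g.degree < n.totient)
    (hg : ∀ ζ : K, IsPrimitiveRoot ζ n → aeval ζ g = 0) : g = 0 := by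
  have hn : 0 < n := Nat.pos_of_ne_zero fun h => NeZero.ne (n : K) (by simp [h])
  have hdvd : cyclotomic n K ∣ g.map (algebraMap F K) := by
    obtain ⟨ζ, hζ⟩ := HasEnoughRootsOfUnity.exists_primitiveRoot K n
    rw [cyclotomic_eq_prod_X_sub_primitiveRoots hζ]
    refine Finset.prod_dvd_of_coprime (fun x _ y _ hxy =>
      pairwise_coprime_X_sub_C Function.injective_id hxy) fun x hx => ?_
    rw [dvd_iff_isRoot, IsRoot.def, eval_map_algebraMap]
    exact hg x ((mem_primitiveRoots hn).1 hx)
  rw [← Polynomial.map_eq_zero (algebraMap F K)]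
  refine eq_zero_of_dvd_of_degree_lt hdvd ?_
  rwa [degree_map, degree_cyclotomic]

theorem stmt13 {F : Type*} [Field F] [Fintype F] (p m j : ℕ) (hp : p.Prime)
    (hodd : Odd p) (hj : 1 ≤ j) (hjm : j ≤ m)
    (hq : Nat.Coprime (2 * p ^ m) (Fintype.card F)) [NeZero (p ^ m)]
    (hcop : Nat.Coprime (Fintype.card F) (p ^ m))
    -- `q` generates the unit group of `ℤ/pᵐ`
    (hgen : orderOf (ZMod.unitOfCoprime (Fintype.card F) hcop) =
      (p ^ m).totient) :
    let D := DihedralGroup (p ^ m)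
    let a : MonoidAlgebra F D := MonoidAlgebra.of F D (DihedralGroup.r 1)
    let b : MonoidAlgebra F D := MonoidAlgebra.of F D (DihedralGroup.sr 0)
    let e : MonoidAlgebra F D :=
      hat F (Subgroup.zpowers (DihedralGroup.r 1 ^ p ^ j)) -
        hat F (Subgroup.zpowers (DihedralGroup.r 1 ^ p ^ (j - 1)))
    let f : MonoidAlgebra F D := ((2 : F)⁻¹ • (1 + b)) * e -
      ((2 : F)⁻¹ • (1 + b)) * a * ((2 : F)⁻¹ • (1 - b)) * e
    let v : Fin ((p ^ j).totient) → MonoidAlgebra F D := fun k => a ^ (k : ℕ) * f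
    LinearIndependent F v ∧
      Submodule.span F (Set.range v) =
        Submodule.restrictScalars F (Ideal.span {f}) := by
  intro D a b e f v
  obtain ⟨i, rfl⟩ : ∃ i, j = i + 1 := ⟨j - 1, by omega⟩
  have hm : m ≠ 0 := by omega
  have coprime_cast_ne_zero (l : ℕ) (hl : l.Prime) (h : l ∣ 2 * p ^ m) : (l : F) ≠ 0 := by
    intro h0
    have hr := Nat.cast_card_eq_zero F
    have hone : ((l.gcd (Fintype.card F) : ℤ) : F) = 0 := by
      rw [Nat.gcd_eq_gcd_ab]
      simp [h0]
    rw [Nat.Coprime.coprime_dvd_left h hq] at hone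
    simp at hone
  have hpF : (p : F) ≠ 0 :=
    coprime_cast_ne_zero p hp ((dvd_pow_self p hm).mul_left 2)
  have h2F : (2 : F) ≠ 0 := by
    exact_mod_cast coprime_cast_ne_zero 2 Nat.prime_two (dvd_mul_right _ _)
  have he : e = Polynomial.aeval a (hatPoly F p m (i + 1) - hatPoly F p m i) := by
    simp only [e, a, D, Nat.add_sub_cancel]
    rw [hat_zpowers_r F hp hjm, hat_zpowers_r F hp (Nat.le_of_succ_le hjm), map_sub]
  have hcomm (g : D) : Commute (MonoidAlgebra.of F D g) e := by
    have (l : ℕ) : (Subgroup.zpowers ((DihedralGroup.r 1 : D) ^ l)).Normal := by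
      rw [DihedralGroup.r_pow]
      exact normal_zpowers_r _
    exact (commute_hat F _ g).sub_right (commute_hat F _ g)
  have hbe : b * e = e * b := hcomm _
  have hae : a * e = e * a := hcomm _
  have hbb : b * b = 1 :=
    (map_mul _ _ _).symm.trans
      ((congrArg _ (DihedralGroup.sr_mul_self 0)).trans (map_one _))
  have hbf : b * f = f := by
    have h : b * ((2 : F)⁻¹ • (1 + b)) = (2 : F)⁻¹ • (1 + b) := by
      rw [mul_smul_comm, mul_add, mul_one, hbb, add_comm]
    simp only [f, mul_sub, ← mul_assoc, h]
  have han : a ^ p ^ m = 1 :=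
    (map_pow _ _ _).symm.trans ((congrArg _ DihedralGroup.r_one_pow_n).trans (map_one _))
  have hcyc : Polynomial.aeval a (Polynomial.cyclotomic (p ^ (i + 1)) F) * f = 0 := by
    have h0 : Polynomial.aeval a (Polynomial.cyclotomic (p ^ (i + 1)) F) * e = 0 := by
      obtain ⟨w, hw⟩ := dvd_cyclotomic_mul_hatPoly_sub F hp hjm hpF
      rw [he, ← map_mul, hw]
      simp [han]
    have hf : f = e * ((2 : F)⁻¹ • (1 + b) -
        ((2 : F)⁻¹ • (1 + b)) * a * ((2 : F)⁻¹ • (1 - b))) := by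
      have h1 : Commute ((2 : F)⁻¹ • (1 + b)) e :=
        ((Commute.one_left e).add_left hbe).smul_left _
      have h2 : Commute ((2 : F)⁻¹ • (1 - b)) e :=
        ((Commute.one_left e).sub_left hbe).smul_left _
      rw [mul_sub, ← h1.eq, ← (Commute.mul_left (Commute.mul_left h1 hae) h2).eq]
    rw [hf, ← mul_assoc, h0, zero_mul]
  -- right multiplication by `1 + b` removes the `e₁₂` part of `f`
  have hfb : f * (1 + b) = (1 + b) * e := by
    have h1 : e * (1 + b) = (1 + b) * e := by
      rw [mul_add, add_mul, hbe, mul_one, one_mul]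
    have h2 : (1 - b) * (1 + b) = 0 := by
      rw [sub_mul, mul_add, mul_add, hbb]
      simp [add_comm]
    have h3 : (1 + b) * (1 + b) = (2 : F) • (1 + b) := by
      rw [add_mul, mul_add, mul_add, hbb, two_smul]
      simp [add_comm]
    rw [sub_mul, mul_assoc _ e, mul_assoc _ e, h1, ← mul_assoc, ← mul_assoc, mul_assoc _ _ (1 + b),
      smul_mul_assoc, smul_mul_assoc _ (1 - b), h2, h3, smul_smul, inv_mul_cancel₀ h2F]
    simp
  constructor
  · rw [Fintype.linearIndependent_iff]
    intro c hc
    let g : Polynomial F := ∑ k, Polynomial.C (c k) * Polynomial.X ^ (k : ℕ)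
    have hgf : Polynomial.aeval a g * f = 0 := by
      rw [← hc]
      simp only [g, v, map_sum, map_mul, Polynomial.aeval_C, map_pow, Polynomial.aeval_X,
        ← Algebra.smul_def]
      rw [Finset.sum_mul]
      exact Finset.sum_congr rfl fun k _ => smul_mul_assoc _ _ _
    have hge : Polynomial.aeval a g * ((1 + b) * e) = 0 := by
      rw [← hfb, ← mul_assoc, hgf, zero_mul]
    let K := AlgebraicClosure F
    have hpK : (p : K) ≠ 0 := by
      rw [← map_natCast (algebraMap F K)]
      exact (map_ne_zero _).2 hpF
    have : NeZero ((p ^ (i + 1) : ℕ) : K) := ⟨by exact_mod_cast pow_ne_zero _ hpK⟩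
    have hg0 : g = 0 := by
      refine eq_zero_of_forall_primitiveRoot (K := K) (n := p ^ (i + 1))
        (Polynomial.degree_sum_fin_lt c) fun ζ hζ => ?_
      have hζm : ζ ^ p ^ m = 1 := (hζ.pow_eq_one_iff_dvd _).2 (pow_dvd_pow p hjm)
      let χ : AddChar (ZMod (p ^ m)) K := AddChar.zmodChar (p ^ m) hζm
      have hχ : χ 1 = ζ := by
        simpa using AddChar.zmodChar_apply' hζm 1
      let ρ : MonoidAlgebra F D →ₐ[F] Matrix (Fin 2) (Fin 2) K :=
        MonoidAlgebra.lift F _ D (dihedralRep χ)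
      have hρa : ρ a = !![ζ, 0; 0, ζ⁻¹] := by
        simp [ρ, a, dihedralRep, hχ, AddChar.map_neg_eq_inv]
      have hρb : ρ b = !![0, 1; 1, 0] := by
        simp [ρ, b, dihedralRep]
      have hρe : ρ e = 1 := by
        rw [he, ← Polynomial.aeval_algHom_apply, hρa, aeval_diagonal,
          aeval_hatPoly_sub hp hjm hpF hζ, aeval_hatPoly_sub hp hjm hpF hζ.inv,
          Matrix.one_fin_two]
      have h := congrArg (fun x => ρ x 0 0) hge
      simpa [hρe, hρb, ← Polynomial.aeval_algHom_apply, hρa, aeval_diagonal,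
        Matrix.one_fin_two] using h
    intro k
    have h := congrArg (fun q => Polynomial.coeff q k) hg0
    simpa [g, Polynomial.finsetSum_coeff, Polynomial.coeff_X_pow, Fin.val_inj] using h
  · have hmem (q : Polynomial F) : Polynomial.aeval a q * f ∈ Submodule.span F (Set.range v) := by
      have h := aeval_mul_mem_span (Polynomial.cyclotomic.monic (p ^ (i + 1)) F) hcyc q
      rwa [Polynomial.natDegree_cyclotomic] at h
    have hr (k : ZMod (p ^ m)) :
        MonoidAlgebra.of F D (DihedralGroup.r k) * f ∈ Submodule.span F (Set.range v) := by
      have h := hmem (Polynomial.X ^ k.val)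
      rwa [map_pow, Polynomial.aeval_X, ← map_pow, DihedralGroup.r_one_pow,
        ZMod.natCast_zmod_val] at h
    apply le_antisymm
    · rw [Submodule.span_le]
      rintro _ ⟨k, rfl⟩
      exact Ideal.mul_mem_left _ _ (Ideal.mem_span_singleton_self f)
    · intro y hy
      obtain ⟨x, rfl⟩ := Ideal.mem_span_singleton'.1 hy
      clear hy
      induction x using MonoidAlgebra.induction_on with
      | of x =>
        rcases x with k | k
        · exact hr k
        · have h : MonoidAlgebra.of F D (DihedralGroup.sr k) =
              MonoidAlgebra.of F D (DihedralGroup.r (-k)) * b := by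
            rw [← map_mul, DihedralGroup.r_mul_sr, zero_sub, neg_neg]
          rw [h, mul_assoc, hbf]
          exact hr _
      | add x y hx hy =>
        rw [add_mul]
        exact Submodule.add_mem _ hx hy
      | smul r x hx =>
        rw [smul_mul_assoc]
        exact Submodule.smul_mem _ _ hx
end
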